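/- Suppose F : ℕ → ℕ∞ satisfies F n ≥ 1 for every n. Then exactly one of the following holds: (1) there exists m : ℕ such that {n | F n ≤ m} is infinite, every eventually different family in 𝒩_F is finite, and there exists a finite maximal eventually different family in 𝒩_F; (2) F tends to ⊤ (for every m : ℕ, F n > m for all sufficiently large n), there exists a maximal eventually different family in 𝒩_F that is closed in ℕ → ℕ and perfect (nonempty, closed, without isolated points), and no countable subset of 𝒩_F is a maximal eventually different family in 𝒩_F. -/

import Mathlib

open scoped ENat

/-- The space `𝒩_F = {g : ℕ → ℕ | ∀ n, g n < F n}`. -/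
def NF (F : ℕ → ℕ∞) : Set (ℕ → ℕ) := {g | ∀ n, (g n : ℕ∞) < F n}

/-- Two functions are eventually different. -/
def EvDiff (g₀ g₁ : ℕ → ℕ) : Prop := {n | g₀ n = g₁ n}.Finite

/-- `E` is an eventually different family in `𝒩_F`. -/
def IsEDF (F : ℕ → ℕ∞) (E : Set (ℕ → ℕ)) : Prop :=
  E ⊆ NF F ∧ ∀ g₀ ∈ E, ∀ g₁ ∈ E, g₀ ≠ g₁ → EvDiff g₀ g₁

/-- `E` is a maximal eventually different family in `𝒩_F`. -/
def IsMEDF (F : ℕ → ℕ∞) (E : Set (ℕ → ℕ)) : Prop :=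
  IsEDF F E ∧ ∀ E' : Set (ℕ → ℕ), IsEDF F E' → E ⊆ E' → E' = E

open Filter Set

/-- A numerical code for the first `l` entries of `f`. -/
def prefixCode {α : Type*} [Encodable α] (f : ℕ → α) (l : ℕ) : ℕ :=
  Encodable.encode (PiNat.res f l)

section prefixCode

variable {α : Type*} [Encodable α]

@[simp] lemma prefixCode_zero (f : ℕ → α) : prefixCode f 0 = 0 := by
  simp [prefixCode]

lemma prefixCode_eq_iff {f g : ℕ → α} {l : ℕ} :
    prefixCode f l = prefixCode g l ↔ ∀ i < l, f i = g i := by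
  simp [prefixCode, PiNat.res_eq_res]

lemma length_eq_of_prefixCode_eq {f g : ℕ → α} {l k : ℕ} (h : prefixCode f l = prefixCode g k) :
    l = k := by
  have := congrArg List.length (Encodable.encode_injective h)
  simpa using this

lemma le_prefixCode (f : ℕ → α) (l : ℕ) : l ≤ prefixCode f l := by
  simpa [prefixCode] using Encodable.length_le_encode (PiNat.res f l)

lemma finite_range_prefixCode {P : Set (ℕ → α)} (hP : ∀ i, ((fun p : ℕ → α => p i) '' P).Finite)
    (l : ℕ) : ((fun p => prefixCode p l) '' P).Finite := by
  suffices h : ((fun p => PiNat.res p l) '' P).Finite by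
    have := h.image Encodable.encode
    rwa [image_image] at this
  induction l with
  | zero => exact (finite_singleton []).subset (by rintro _ ⟨p, -, rfl⟩; simp)
  | succ l ih =>
    refine ((hP l).image2 List.cons ih).subset ?_
    rintro _ ⟨p, hp, rfl⟩
    exact ⟨p l, mem_image_of_mem _ hp, _, mem_image_of_mem _ hp, rfl⟩

end prefixCode

/-- The codes of the initial segments of `t`. -/
def branch (t : ℕ → ℕ) : Set ℕ := range (prefixCode t)

lemma branch_infinite (t : ℕ → ℕ) : (branch t).Infinite :=
  infinite_range_of_injective fun _ _ h => length_eq_of_prefixCode_eq h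

lemma branch_inter_finite {t t' : ℕ → ℕ} (h : t ≠ t') : (branch t ∩ branch t').Finite := by
  obtain ⟨n, hn⟩ := Function.ne_iff.1 h
  refine ((finite_Iic n).image (prefixCode t)).subset ?_
  rintro _ ⟨⟨l, rfl⟩, k, hk⟩
  obtain rfl := length_eq_of_prefixCode_eq hk
  refine mem_image_of_mem _ (mem_Iic.2 (not_lt.1 fun hl => hn ?_))
  exact (prefixCode_eq_iff.1 hk n hl).symm

lemma mem_branch_congr {t t' : ℕ → ℕ} {n : ℕ} (h : ∀ i < n, t i = t' i) :
    n ∈ branch t ↔ n ∈ branch t' := by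
  have key : ∀ {t t' : ℕ → ℕ}, (∀ i < n, t i = t' i) → n ∈ branch t → n ∈ branch t' := by
    rintro t t' h ⟨l, rfl⟩
    exact ⟨l, (prefixCode_eq_iff.2 fun i hi => h i (hi.trans_le (le_prefixCode t l))).symm⟩
  exact ⟨key h, key fun i hi => (h i hi).symm⟩

/-- The parameters: pairs of a function bounded by `G` and a sequence of bits. -/
def paramSpace (G : ℕ → ℕ∞) : Set (ℕ → ℕ × Bool) := {p | ∀ i, ((p i).1 : ℕ∞) < G i}

/-- The nodes `m < n` of `branch t` are coherent: the values of `t` there code initial segments,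
of lengths `w m` and `w n`, of a single parameter. -/
def Coheres (G : ℕ → ℕ∞) (w t : ℕ → ℕ) (m n : ℕ) : Prop :=
  m < n ∧ m ∈ branch t ∧ n ∈ branch t ∧
    ∃ q ∈ paramSpace G, t m = prefixCode q (w m) ∧ t n = prefixCode q (w n)

open Classical in
/-- The nodes coherent with and below `n`. -/
noncomputable def preds (G : ℕ → ℕ∞) (w t : ℕ → ℕ) (n : ℕ) : Finset ℕ :=
  (Finset.range n).filter fun m => Coheres G w t m n

/-- The height of `n` in the forest given by coherence. -/
noncomputable def level (G : ℕ → ℕ∞) (w t : ℕ → ℕ) (n : ℕ) : ℕ := (preds G w t n).card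

section Coheres

variable {G : ℕ → ℕ∞} {w t : ℕ → ℕ} {l m n : ℕ}

lemma mem_preds : m ∈ preds G w t n ↔ Coheres G w t m n := by
  simp only [preds, Finset.mem_filter, Finset.mem_range, and_iff_right_iff_imp]
  exact fun h => h.1

lemma level_le : level G w t n ≤ n := by
  classical
  exact (Finset.card_filter_le _ _).trans (Finset.card_range n).le

lemma Coheres.trans (hw : Monotone w) (h₁ : Coheres G w t l m) (h₂ : Coheres G w t m n) :
    Coheres G w t l n := by
  obtain ⟨hlm, hl, -, q, -, hql, hqm⟩ := h₁
  obtain ⟨hmn, -, hn, r, hr, hrm, hrn⟩ := h₂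
  refine ⟨hlm.trans hmn, hl, hn, r, hr, ?_, hrn⟩
  rw [hql, prefixCode_eq_iff]
  exact fun i hi => prefixCode_eq_iff.1 (hqm.symm.trans hrm) i (hi.trans_le (hw hlm.le))

lemma Coheres.of_common (hw : Monotone w) (h₁ : Coheres G w t l n) (h₂ : Coheres G w t m n)
    (hlm : l < m) : Coheres G w t l m := by
  obtain ⟨hln, hl, -, q, -, hql, hqn⟩ := h₁
  obtain ⟨hmn, hm, -, r, hr, hrm, hrn⟩ := h₂
  refine ⟨hlm, hl, hm, r, hr, ?_, hrm⟩
  rw [hql, prefixCode_eq_iff]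
  exact fun i hi => prefixCode_eq_iff.1 (hqn.symm.trans hrn) i (hi.trans_le (hw hln.le))

lemma level_lt_of_coheres (hw : Monotone w) (h : Coheres G w t m n) :
    level G w t m < level G w t n := by
  refine Finset.card_lt_card (Finset.ssubset_iff_of_subset ?_ |>.2 ⟨m, mem_preds.2 h, ?_⟩)
  · exact fun l hl => mem_preds.2 ((mem_preds.1 hl).trans hw h)
  · exact fun hm => lt_irrefl m (mem_preds.1 hm).1

lemma exists_coheres_level_eq (hw : Monotone w) {k : ℕ} :
    ∀ {n}, k < level G w t n → ∃ m, Coheres G w t m n ∧ level G w t m = k := by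
  intro n
  induction n using Nat.strong_induction_on with
  | _ n ih =>
    intro hk
    have hne : (preds G w t n).Nonempty := Finset.card_pos.1 (hk.trans_le' (Nat.zero_le k))
    set m := (preds G w t n).max' hne with hm
    have hmn : Coheres G w t m n := mem_preds.1 (Finset.max'_mem _ hne)
    have hpred : preds G w t m = (preds G w t n).erase m := by
      ext l
      simp only [Finset.mem_erase, mem_preds]
      refine ⟨fun h => ⟨h.1.ne, h.trans hw hmn⟩, fun h => h.2.of_common hw hmn ?_⟩
      exact lt_of_le_of_ne (Finset.le_max' _ _ (mem_preds.2 h.2)) h.1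
    have hlev : level G w t m = level G w t n - 1 := by
      rw [level, hpred, Finset.card_erase_of_mem (mem_preds.2 hmn), level]
    rcases eq_or_ne (level G w t m) k with h | h
    · exact ⟨m, hmn, h⟩
    · obtain ⟨l, hl, hlk⟩ := ih m hmn.1 (by omega)
      exact ⟨l, hl.trans hw hmn, hlk⟩

lemma coheres_congr {t' : ℕ → ℕ} (h : ∀ i ≤ n, t i = t' i) :
    Coheres G w t m n ↔ Coheres G w t' m n := by
  refine and_congr_right fun hmn => ?_
  rw [mem_branch_congr fun i hi => h i (hi.trans hmn).le, mem_branch_congr fun i hi => h i hi.le,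
    h m hmn.le, h n le_rfl]

lemma level_congr {t' : ℕ → ℕ} (h : ∀ i ≤ n, t i = t' i) : level G w t n = level G w t' n := by
  have : preds G w t n = preds G w t' n := by
    ext m
    rw [mem_preds, mem_preds, coheres_congr h]
  rw [level, level, this]

/-- A coherent infinite chain of nodes determines a parameter. -/
lemma exists_param_of_chain (hwt : Tendsto w atTop atTop) {C : Set ℕ} (hC : C.Infinite)
    (hsub : ∀ m ∈ C, ∃ q ∈ paramSpace G, t m = prefixCode q (w m))
    (hchain : ∀ m ∈ C, ∀ n ∈ C, m < n → Coheres G w t m n) :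
    ∃ q ∈ paramSpace G, ∀ m ∈ C, t m = prefixCode q (w m) := by
  choose! q hqP hq using hsub
  have hcompat : ∀ m ∈ C, ∀ n ∈ C, ∀ i, i < w m → i < w n → q m i = q n i := by
    intro m hm n hn i him hin
    wlog hmn : m < n generalizing m n
    · rcases eq_or_lt_of_le (not_lt.1 hmn) with rfl | h
      · rfl
      · exact (this n hn m hm hin him h).symm
    obtain ⟨-, -, -, r, -, hrm, hrn⟩ := hchain m hm n hn hmn
    exact (prefixCode_eq_iff.1 ((hq m hm).symm.trans hrm) i him).trans
      (prefixCode_eq_iff.1 ((hq n hn).symm.trans hrn) i hin).symm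
  have hlarge : ∀ i, ∃ m ∈ C, i < w m := by
    intro i
    obtain ⟨N, hN⟩ := eventually_atTop.1 (hwt.eventually_gt_atTop i)
    obtain ⟨m, hm, hNm⟩ := hC.exists_gt N
    exact ⟨m, hm, hN m hNm.le⟩
  choose c hcC hc using hlarge
  refine ⟨fun i => q (c i) i, fun i => hqP _ (hcC i) i, fun m hm => ?_⟩
  rw [hq m hm, prefixCode_eq_iff]
  exact fun i hi => hcompat m hm _ (hcC i) i hi (hc i)

/-- If all levels are finite, there is an infinite coherent chain. -/
lemma exists_param_of_finite_levels (hw : Monotone w) (hwt : Tendsto w atTop atTop)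
    (hfin : ∀ k, {n ∈ branch t | level G w t n = k}.Finite) :
    ∃ q ∈ paramSpace G, {n ∈ branch t | t n = prefixCode q (w n)}.Infinite := by
  have : NeBot (cofinite ⊓ 𝓟 (branch t)) :=
    cofinite_inf_principal_neBot_iff.2 (branch_infinite t)
  set U : Ultrafilter ℕ := Ultrafilter.of (cofinite ⊓ 𝓟 (branch t))
  have hU : (U : Filter ℕ) ≤ cofinite ⊓ 𝓟 (branch t) := Ultrafilter.of_le _
  have hUB : ∀ᶠ n in U, n ∈ branch t := hU (mem_inf_of_right (mem_principal_self _))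
  have hUfin : ∀ s : Set ℕ, s.Finite → ∀ᶠ n in U, n ∉ s := fun s hs =>
    hU (mem_inf_of_left hs.compl_mem_cofinite)
  set C : Set ℕ := {m | ∀ᶠ n in U, Coheres G w t m n} with hCdef
  have hlevel : ∀ k, ∃ m ∈ C, level G w t m = k := by
    intro k
    have hle : ∀ᶠ n in U, k < level G w t n := by
      filter_upwards [hUB, hUfin _ ((finite_Iic k).biUnion fun i _ => hfin i)] with n hn hn'
      refine not_le.1 fun h => hn' ?_
      simp only [mem_iUnion]
      exact ⟨_, h, hn, rfl⟩
    have : ∀ᶠ n in U, ∃ m ∈ {n ∈ branch t | level G w t n = k}, Coheres G w t m n := by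
      filter_upwards [hle] with n hn
      obtain ⟨m, hm, hmk⟩ := exists_coheres_level_eq hw hn
      exact ⟨m, ⟨hm.2.1, hmk⟩, hm⟩
    obtain ⟨m, hm, hmU⟩ := (Ultrafilter.eventually_exists_mem_iff (hfin k)).1 this
    exact ⟨m, hmU, hm.2⟩
  have hCinf : C.Infinite := by
    intro hC
    refine infinite_univ (α := ℕ) ((hC.image (level G w t)).subset fun k _ => ?_)
    obtain ⟨m, hm, hmk⟩ := hlevel k
    exact ⟨m, hm, hmk⟩
  obtain ⟨q, hq, hqC⟩ := exists_param_of_chain (G := G) (w := w) (t := t) hwt hCinf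
    (fun m hm => by
      obtain ⟨n, -, -, -, q, hq, hqm, -⟩ := Eventually.exists hm
      exact ⟨q, hq, hqm⟩)
    (fun m hm n hn hmn => by
      obtain ⟨l, hml, hnl⟩ := (Eventually.and hm hn).exists
      exact hml.of_common hw hnl hmn)
  refine ⟨q, hq, hCinf.mono fun m hm => ⟨?_, hqC m hm⟩⟩
  obtain ⟨n, hn⟩ := Eventually.exists hm
  exact hn.2.1

end Coheres

/-- The function component of a parameter. -/
def target (p : ℕ → ℕ × Bool) (i : ℕ) : ℕ := (p i).1

/-- The nodes of `branch (target p)` at which `p` follows its target: those on the level that the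
bits of `p` single out. -/
def followSet (G : ℕ → ℕ∞) (w : ℕ → ℕ) (p : ℕ → ℕ × Bool) : Set ℕ :=
  {i ∈ branch (target p) | ∀ s ≤ i, (p s).2 = decide (s = level G w (target p) i)}

section followSet

variable {G : ℕ → ℕ∞} {w : ℕ → ℕ} {p q : ℕ → ℕ × Bool} {m n : ℕ}

lemma mem_followSet_congr (h : ∀ i ≤ n, p i = q i) :
    n ∈ followSet G w p ↔ n ∈ followSet G w q := by
  have ht : ∀ i ≤ n, target p i = target q i := fun i hi => congrArg Prod.fst (h i hi)
  refine and_congr (mem_branch_congr fun i hi => ht i hi.le) (forall₂_congr fun s hs => ?_)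
  rw [h s hs, level_congr ht]

lemma not_coheres_of_mem_followSet (hw : Monotone w) (hm : m ∈ followSet G w p)
    (hn : n ∈ followSet G w p) : ¬ Coheres G w (target p) m n := by
  intro h
  have hle : level G w (target p) m ≤ m := level_le
  have hm' := hm.2 _ hle
  rw [hn.2 _ (hle.trans h.1.le)] at hm'
  have : level G w (target p) m = level G w (target p) n := by simpa using hm'
  exact (level_lt_of_coheres hw h).ne this

lemma followSet_inter_finite (h : p ≠ q) : (followSet G w p ∩ followSet G w q).Finite := by
  by_cases ht : target p = target q
  · obtain ⟨s, hs⟩ := Function.ne_iff.1 h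
    refine (finite_Iio s).subset fun n ⟨hp, hq⟩ => mem_Iio.2 (not_le.1 fun hsn => hs (Prod.ext ?_ ?_))
    · exact congrFun ht s
    · rw [hp.2 s hsn, hq.2 s hsn, ht]
  · exact (branch_inter_finite ht).subset fun n hn => ⟨hn.1.1, hn.2.1⟩

lemma followSet_inter_code_finite (hw : Monotone w) (hq : q ∈ paramSpace G) :
    {n ∈ followSet G w p | target p n = prefixCode q (w n)}.Finite := by
  refine Subsingleton.finite fun m hm n hn => ?_
  by_contra hne
  wlog hmn : m < n generalizing m n
  · exact this n hn m hm (Ne.symm hne) (lt_of_le_of_ne (not_lt.1 hmn) (Ne.symm hne))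
  exact not_coheres_of_mem_followSet hw hm.1 hn.1 ⟨hmn, hm.1.1, hn.1.1, q, hq, hm.2, hn.2⟩

end followSet

open Classical in
/-- The member of the family with parameter `p`: it follows the target of `p` on `followSet`, and
codes longer and longer initial segments of `p` elsewhere. -/
noncomputable def member (F : ℕ → ℕ∞) (a j : ℕ → ℕ) (p : ℕ → ℕ × Bool) (n : ℕ) : ℕ :=
  if h : ∃ i, a i = n ∧ i ∈ followSet (F ∘ a) (j ∘ a) p then target p h.choose
  else prefixCode p (j n)

section member

variable {F : ℕ → ℕ∞} {a j : ℕ → ℕ} {p q : ℕ → ℕ × Bool}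

lemma member_of_mem (ha : StrictMono a) {i : ℕ} (h : i ∈ followSet (F ∘ a) (j ∘ a) p) :
    member F a j p (a i) = target p i := by
  have hex : ∃ k, a k = a i ∧ k ∈ followSet (F ∘ a) (j ∘ a) p := ⟨i, rfl, h⟩
  rw [member, dif_pos hex, ha.injective hex.choose_spec.1]

lemma member_of_notMem (ha : StrictMono a) {i : ℕ} (h : i ∉ followSet (F ∘ a) (j ∘ a) p) :
    member F a j p (a i) = prefixCode p (j (a i)) := by
  refine dif_neg ?_
  rintro ⟨k, hk, hkp⟩
  exact h (ha.injective hk ▸ hkp)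

lemma member_of_notMem_range {n : ℕ} (h : n ∉ range a) :
    member F a j p n = prefixCode p (j n) :=
  dif_neg fun ⟨i, hi, _⟩ => h ⟨i, hi⟩

lemma member_congr (ha : StrictMono a) (n : ℕ) :
    ∃ N, ∀ p q : ℕ → ℕ × Bool, (∀ i < N, p i = q i) → member F a j p n = member F a j q n := by
  by_cases hn : n ∈ range a
  · obtain ⟨i, rfl⟩ := hn
    refine ⟨max (i + 1) (j (a i)), fun p q h => ?_⟩
    have hi : ∀ s ≤ i, p s = q s := fun s hs => h s (lt_max_of_lt_left (Nat.lt_succ_of_le hs))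
    by_cases hp : i ∈ followSet (F ∘ a) (j ∘ a) p
    · rw [member_of_mem ha hp, member_of_mem ha ((mem_followSet_congr hi).1 hp)]
      exact congrArg Prod.fst (hi i le_rfl)
    · rw [member_of_notMem ha hp, member_of_notMem ha (mt (mem_followSet_congr hi).2 hp),
        prefixCode_eq_iff]
      exact fun s hs => h s (lt_max_of_lt_right hs)
  · refine ⟨j n, fun p q h => ?_⟩
    rw [member_of_notMem_range hn, member_of_notMem_range hn, prefixCode_eq_iff]
    exact h

lemma member_congr_lt (ha : StrictMono a) (n : ℕ) :
    ∃ N, ∀ p q : ℕ → ℕ × Bool, (∀ i < N, p i = q i) →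
      ∀ m < n, member F a j p m = member F a j q m := by
  choose N hN using member_congr (F := F) (j := j) ha
  refine ⟨(Finset.range n).sup N, fun p q h m hm => hN m p q fun i hi => h i ?_⟩
  exact hi.trans_le (Finset.le_sup (Finset.mem_range.2 hm))

lemma member_mem_NF (ha : StrictMono a)
    (hbound : ∀ n, ∀ p ∈ paramSpace (F ∘ a), (prefixCode p (j n) : ℕ∞) < F n)
    (hp : p ∈ paramSpace (F ∘ a)) : member F a j p ∈ NF F := by
  intro n
  by_cases hn : n ∈ range a
  · obtain ⟨i, rfl⟩ := hn
    by_cases h : i ∈ followSet (F ∘ a) (j ∘ a) p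
    · rw [member_of_mem ha h]
      exact hp i
    · rw [member_of_notMem ha h]
      exact hbound _ p hp
  · rw [member_of_notMem_range hn]
    exact hbound _ p hp

lemma prefixCode_agree_finite (hjt : Tendsto j atTop atTop) (h : p ≠ q) :
    {n | prefixCode p (j n) = prefixCode q (j n)}.Finite := by
  obtain ⟨s, hs⟩ := Function.ne_iff.1 h
  obtain ⟨N, hN⟩ := eventually_atTop.1 (hjt.eventually_gt_atTop s)
  refine (finite_Iio N).subset fun n hn => mem_Iio.2 (not_le.1 fun hNn => hs ?_)
  exact prefixCode_eq_iff.1 hn s (hN n hNn)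

lemma evDiff_member (ha : StrictMono a) (hj : Monotone j) (hjt : Tendsto j atTop atTop)
    (hp : p ∈ paramSpace (F ∘ a)) (hq : q ∈ paramSpace (F ∘ a)) (h : p ≠ q) :
    EvDiff (member F a j p) (member F a j q) := by
  have hw : Monotone (j ∘ a) := hj.comp ha.monotone
  refine ((prefixCode_agree_finite hjt h).union
    ((((followSet_inter_finite (G := F ∘ a) (w := j ∘ a) h).union
      (followSet_inter_code_finite (p := p) hw hq)).union
      (followSet_inter_code_finite (p := q) hw hp)).image a)).subset ?_
  intro n (hn : member F a j p n = member F a j q n)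
  by_cases hna : n ∈ range a
  · obtain ⟨i, rfl⟩ := hna
    by_cases hip : i ∈ followSet (F ∘ a) (j ∘ a) p <;>
      by_cases hiq : i ∈ followSet (F ∘ a) (j ∘ a) q
    · exact Or.inr (mem_image_of_mem a (Or.inl (Or.inl ⟨hip, hiq⟩)))
    · rw [member_of_mem ha hip, member_of_notMem ha hiq] at hn
      exact Or.inr (mem_image_of_mem a (Or.inl (Or.inr ⟨hip, hn⟩)))
    · rw [member_of_notMem ha hip, member_of_mem ha hiq] at hn
      exact Or.inr (mem_image_of_mem a (Or.inr ⟨hiq, hn.symm⟩))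
    · rw [member_of_notMem ha hip, member_of_notMem ha hiq] at hn
      exact Or.inl hn
  · rw [member_of_notMem_range hna, member_of_notMem_range hna] at hn
    exact Or.inl hn

/-- Every function in `𝒩_F` agrees infinitely often with a member of the family. -/
lemma exists_member_not_evDiff (ha : StrictMono a) (hj : Monotone j)
    (hjt : Tendsto j atTop atTop) {h : ℕ → ℕ} (hh : h ∈ NF F) :
    ∃ p ∈ paramSpace (F ∘ a), ¬ EvDiff h (member F a j p) := by
  have hw : Monotone (j ∘ a) := hj.comp ha.monotone
  have hwt : Tendsto (j ∘ a) atTop atTop := hjt.comp ha.tendsto_atTop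
  suffices H : ∃ p ∈ paramSpace (F ∘ a), {i | h (a i) = member F a j p (a i)}.Infinite by
    obtain ⟨p, hp, hinf⟩ := H
    exact ⟨p, hp, fun hfin => hinf (hfin.preimage ha.injective.injOn)⟩
  by_cases hlev : ∃ k, {n ∈ branch (h ∘ a) | level (F ∘ a) (j ∘ a) (h ∘ a) n = k}.Infinite
  · obtain ⟨k, hk⟩ := hlev
    refine ⟨fun s => (h (a s), decide (s = k)), fun i => hh (a i), hk.mono ?_⟩
    rintro n ⟨hn, rfl⟩
    exact (member_of_mem (p := fun s => (h (a s), decide (s = _))) ha ⟨hn, fun s _ => rfl⟩).symm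
  · simp only [not_exists, not_infinite] at hlev
    obtain ⟨q, hq, hinf⟩ := exists_param_of_finite_levels hw hwt hlev
    refine ⟨q, hq, ?_⟩
    have hagree : ∀ i, (h ∘ a) i = prefixCode q ((j ∘ a) i) →
        (i ∉ branch (target q) ∨ h ∘ a = target q) → h (a i) = member F a j q (a i) := by
      intro i hi hor
      by_cases hiq : i ∈ followSet (F ∘ a) (j ∘ a) q
      · rw [member_of_mem ha hiq]
        exact congrFun (hor.resolve_left fun h => h hiq.1) i
      · rw [member_of_notMem ha hiq]
        exact hi
    by_cases heq : h ∘ a = target q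
    · exact hinf.mono fun i hi => hagree i hi.2 (Or.inr heq)
    · refine (hinf.sdiff (branch_inter_finite heq)).mono fun i hi => hagree i hi.1.2 ?_
      exact Or.inl fun hiq => hi.2 ⟨hi.1.1, hiq⟩

/-- The family of all members is closed. -/
lemma isClosed_image_member (ha : StrictMono a) (hac : (range a)ᶜ.Infinite)
    (hjt : Tendsto j atTop atTop) : IsClosed (member F a j '' paramSpace (F ∘ a)) := by
  refine isClosed_of_closure_subset fun g hg => ?_
  have happrox : ∀ N, ∃ p ∈ paramSpace (F ∘ a), ∀ n < N, member F a j p n = g n := by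
    intro N
    obtain ⟨_, hy, p, hp, rfl⟩ := mem_closure_iff.1 hg _ (PiNat.isOpen_cylinder _ g N)
      (PiNat.self_mem_cylinder g N)
    exact ⟨p, hp, fun n hn => PiNat.mem_cylinder_iff.1 hy n hn⟩
  choose p hp hpg using happrox
  have hstab : ∀ l, ∃ M, ∀ N ≥ M, ∀ N' ≥ M, ∀ i < l, p N i = p N' i := by
    intro l
    obtain ⟨K, hK⟩ := eventually_atTop.1 (hjt.eventually_ge_atTop l)
    obtain ⟨n, hn, hKn⟩ := hac.exists_gt K
    refine ⟨n + 1, fun N hN N' hN' i hi => ?_⟩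
    have h := (hpg N n hN).trans (hpg N' n hN').symm
    rw [member_of_notMem_range hn, member_of_notMem_range hn, prefixCode_eq_iff] at h
    exact h i (hi.trans_le (hK n hKn.le))
  choose M hM using hstab
  refine ⟨fun i => p (M (i + 1)) i, fun i => hp _ i, funext fun n => ?_⟩
  obtain ⟨L, hL⟩ := member_congr (F := F) (j := j) ha n
  set N := max (n + 1) ((Finset.range (L + 1)).sup M)
  rw [← hpg N n (Nat.lt_of_succ_le (le_max_left _ _))]
  refine hL _ _ fun i hi => hM (i + 1) _ le_rfl _ (le_max_of_le_right ?_) i i.lt_succ_self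
  exact Finset.le_sup (Finset.mem_range.2 (Nat.succ_lt_succ hi))

/-- The family of all members has no isolated points. -/
lemma preperfect_image_member (ha : StrictMono a) (hj : Monotone j)
    (hjt : Tendsto j atTop atTop) : Preperfect (member F a j '' paramSpace (F ∘ a)) := by
  rw [preperfect_iff_nhds]
  rintro _ ⟨p, hp, rfl⟩ U hU
  obtain ⟨_, ⟨g, n, rfl⟩, hgn, hsub⟩ :=
    (PiNat.isTopologicalBasis_cylinders fun _ : ℕ => ℕ).mem_nhds_iff.1 hU
  obtain ⟨N, hN⟩ := member_congr_lt (F := F) (j := j) ha n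
  set q : ℕ → ℕ × Bool := Function.update p N ((p N).1, !(p N).2) with hqdef
  have hne : q ≠ p := fun h => by
    have := congrArg Prod.snd (congrFun h N)
    simp [hqdef] at this
  have hq : q ∈ paramSpace (F ∘ a) := by
    intro i
    rcases eq_or_ne i N with rfl | hi
    · simpa [hqdef] using hp i
    · simpa [hqdef, hi] using hp i
  refine ⟨member F a j q, ⟨hsub ?_, mem_image_of_mem _ hq⟩, fun h => ?_⟩
  · rw [PiNat.mem_cylinder_iff] at hgn ⊢
    intro m hm
    rw [← hgn m hm]
    exact hN q p (fun i hi => by simp [hqdef, hi.ne]) m hm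
  · have := evDiff_member ha hj hjt hq hp hne
    rw [h] at this
    exact infinite_univ (this.subset fun n _ => rfl)

lemma isMEDF_image_member (ha : StrictMono a) (hj : Monotone j) (hjt : Tendsto j atTop atTop)
    (hbound : ∀ n, ∀ p ∈ paramSpace (F ∘ a), (prefixCode p (j n) : ℕ∞) < F n) :
    IsMEDF F (member F a j '' paramSpace (F ∘ a)) := by
  refine ⟨⟨?_, ?_⟩, fun E' hE' hsub => Subset.antisymm (fun h hh => ?_) hsub⟩
  · rintro _ ⟨p, hp, rfl⟩
    exact member_mem_NF ha hbound hp
  · rintro _ ⟨p, hp, rfl⟩ _ ⟨q, hq, rfl⟩ hne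
    exact evDiff_member ha hj hjt hp hq fun h => hne (h ▸ rfl)
  · obtain ⟨p, hp, hev⟩ := exists_member_not_evDiff ha hj hjt (hE'.1 hh)
    have hmem := mem_image_of_mem (member F a j) hp
    by_contra hnot
    exact hev (hE'.2 h hh _ (hsub hmem) fun heq => hnot (heq ▸ hmem))

end member

/-- A slowly growing `j` such that the codes of length `j n` stay below `F n`. -/
lemma exists_codeLength {F : ℕ → ℕ∞} (h1 : ∀ n, 1 ≤ F n) {P : Set (ℕ → ℕ × Bool)}
    (hP : ∀ l, ∀ᶠ n in atTop, ∀ p ∈ P, (prefixCode p l : ℕ∞) < F n) :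
    ∃ j : ℕ → ℕ, Monotone j ∧ Tendsto j atTop atTop ∧
      ∀ n, ∀ p ∈ P, (prefixCode p (j n) : ℕ∞) < F n := by
  classical
  let Q : ℕ → ℕ → Prop := fun n l => ∀ m ≥ n, ∀ p ∈ P, (prefixCode p l : ℕ∞) < F m
  have hQ0 : ∀ n, Q n 0 := fun n m _ p _ => by
    simpa using zero_lt_one.trans_le (h1 m)
  refine ⟨fun n => Nat.findGreatest (Q n) n, fun m n hmn => ?_, ?_, fun n => ?_⟩
  · exact Nat.findGreatest_mono (fun l hl k hk => hl k (hmn.trans hk)) hmn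
  · refine tendsto_atTop.2 fun l => ?_
    obtain ⟨N, hN⟩ := eventually_atTop.1 (hP l)
    filter_upwards [eventually_ge_atTop (max N l)] with n hn
    exact Nat.le_findGreatest (le_of_max_le_right hn)
      fun m hm => hN m ((le_of_max_le_left hn).trans hm)
  · exact Nat.findGreatest_spec (P := Q n) (Nat.zero_le n) (hQ0 n) n le_rfl

/-- If `F` tends to `⊤` then the positions at which targets are followed can be chosen so that the
codes of parameters of every fixed length are eventually below `F`. -/
lemma exists_positions {F : ℕ → ℕ∞} (hF : ∀ m : ℕ, ∀ᶠ n in atTop, (m : ℕ∞) < F n) :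
    ∃ a : ℕ → ℕ, StrictMono a ∧ (range a)ᶜ.Infinite ∧
      ∀ l, ∀ᶠ n in atTop, ∀ p ∈ paramSpace (F ∘ a), (prefixCode p l : ℕ∞) < F n := by
  have hodd : ∀ b : ℕ → ℕ, StrictMono b → StrictMono (fun i => b (2 * i + 1)) ∧
      (range fun i => b (2 * i + 1))ᶜ.Infinite := by
    intro b hb
    refine ⟨fun i k hik => hb (by omega), ?_⟩
    refine (infinite_range_of_injective (f := fun i => b (2 * i)) fun i k hik => ?_).mono ?_
    · have := hb.injective hik
      omega
    · rintro _ ⟨i, rfl⟩ ⟨k, hk⟩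
      have := hb.injective hk
      omega
  by_cases hfin : {n | F n ≠ ⊤}.Finite
  · refine ⟨_, (hodd id strictMono_id).1, (hodd id strictMono_id).2, fun l => ?_⟩
    filter_upwards [Nat.cofinite_eq_atTop ▸ hfin.compl_mem_cofinite] with n hn p _
    rw [not_ne_iff.1 hn]
    exact ENat.natCast_lt_top _
  · have hb := Nat.nth_strictMono (p := fun n => F n ≠ ⊤) hfin
    refine ⟨_, (hodd _ hb).1, (hodd _ hb).2, fun l => ?_⟩
    set a : ℕ → ℕ := fun i => Nat.nth (fun n => F n ≠ ⊤) (2 * i + 1)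
    have hP : ∀ i, ((fun p : ℕ → ℕ × Bool => p i) '' paramSpace (F ∘ a)).Finite := by
      intro i
      obtain ⟨m, hm⟩ := ENat.ne_top_iff_exists.1
        (Nat.nth_mem_of_infinite (p := fun n => F n ≠ ⊤) hfin (2 * i + 1))
      refine ((finite_Iio m).prod (finite_univ (α := Bool))).subset ?_
      rintro _ ⟨p, hp, rfl⟩
      have := hp i
      rw [Function.comp_apply, ← hm] at this
      exact ⟨by exact_mod_cast this, trivial⟩
    obtain ⟨B, hB⟩ := (finite_range_prefixCode hP l).bddAbove
    filter_upwards [hF B] with n hn p hp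
    refine lt_of_le_of_lt ?_ hn
    exact_mod_cast hB (mem_image_of_mem _ hp)

lemma exists_perfect_isMEDF {F : ℕ → ℕ∞} (h1 : ∀ n, 1 ≤ F n)
    (hF : ∀ m : ℕ, ∀ᶠ n in atTop, (m : ℕ∞) < F n) :
    ∃ E : Set (ℕ → ℕ), IsMEDF F E ∧ IsClosed E ∧ Perfect E ∧ E.Nonempty := by
  obtain ⟨a, ha, hac, hcode⟩ := exists_positions hF
  obtain ⟨j, hj, hjt, hbound⟩ := exists_codeLength h1 hcode
  have hclosed := isClosed_image_member (F := F) ha hac hjt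
  refine ⟨_, isMEDF_image_member ha hj hjt hbound, hclosed,
    ⟨hclosed, preperfect_image_member ha hj hjt⟩, Nonempty.image _ ⟨fun _ => (0, false), ?_⟩⟩
  exact fun i => by simpa using zero_lt_one.trans_le (h1 (a i))

lemma not_evDiff_self (g : ℕ → ℕ) : ¬ EvDiff g g := fun h =>
  infinite_univ (h.subset fun _ _ => rfl)

lemma EvDiff.symm {g h : ℕ → ℕ} (H : EvDiff g h) : EvDiff h g :=
  Finite.subset H fun _ hn => Eq.symm hn

lemma not_isMEDF_of_countable {F : ℕ → ℕ∞} (h1 : ∀ n, 1 ≤ F n)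
    (hF : ∀ m : ℕ, ∀ᶠ n in atTop, (m : ℕ∞) < F n) {E : Set (ℕ → ℕ)} (hE : E.Countable) :
    ¬ IsMEDF F E := by
  classical
  rintro ⟨hEDF, hmax⟩
  obtain ⟨u, hu⟩ := countable_iff_exists_subset_range.1 hE
  let r : ℕ → ℕ := fun n => Nat.findGreatest (fun l => (l : ℕ∞) < F n) n
  have hr : ∀ n, (r n : ℕ∞) < F n := fun n =>
    Nat.findGreatest_spec (P := fun l : ℕ => (l : ℕ∞) < F n) (Nat.zero_le n)
      (by simpa using zero_lt_one.trans_le (h1 n))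
  have hfresh : ∀ n, ∃ v ≤ r n, ∀ i < r n, u i n ≠ v := by
    intro n
    obtain ⟨v, hv, hv'⟩ := Finset.exists_mem_notMem_of_card_lt_card
      (s := (Finset.range (r n)).image fun i => u i n) (t := Finset.range (r n + 1))
      (by simpa using Nat.lt_succ_of_le (Finset.card_image_le.trans (Finset.card_range (r n)).le))
    refine ⟨v, Nat.lt_succ_iff.1 (Finset.mem_range.1 hv), fun i hi hiv => hv' ?_⟩
    exact Finset.mem_image.2 ⟨i, Finset.mem_range.2 hi, hiv⟩
  choose h hhr hh using hfresh
  have hdiff : ∀ g ∈ E, EvDiff g h := by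
    intro g hg
    obtain ⟨i, rfl⟩ := hu hg
    obtain ⟨N, hN⟩ := eventually_atTop.1 (hF (i + 1))
    refine (finite_Iio (max N (i + 1))).subset fun n hn => mem_Iio.2 (not_le.1 fun hle => ?_)
    refine hh n i ?_ hn
    exact Nat.le_findGreatest (le_of_max_le_right hle) (hN n (le_of_max_le_left hle))
  have hins : IsEDF F (insert h E) := by
    refine ⟨insert_subset (fun n => ?_) hEDF.1, ?_⟩
    · exact lt_of_le_of_lt (by exact_mod_cast hhr n) (hr n)
    · rintro g₀ (rfl | hg₀) g₁ (rfl | hg₁) hne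
      · exact absurd rfl hne
      · exact (hdiff g₁ hg₁).symm
      · exact hdiff g₀ hg₀
      · exact hEDF.2 g₀ hg₀ g₁ hg₁ hne
  have hmem : h ∈ E := hmax _ hins (subset_insert _ _) ▸ mem_insert h E
  exact not_evDiff_self h (hdiff h hmem)

lemma IsEDF.finite {F : ℕ → ℕ∞} {m : ℕ} (hm : {n : ℕ | F n ≤ (m : ℕ∞)}.Infinite)
    {E : Set (ℕ → ℕ)} (hE : IsEDF F E) : E.Finite := by
  by_contra hinf
  obtain ⟨s, hsE, hs⟩ := Set.Infinite.exists_subset_card_eq hinf (m + 1)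
  have hfin : (⋃ g ∈ s, ⋃ h ∈ s, {n | g ≠ h ∧ g n = h n}).Finite := by
    refine s.finite_toSet.biUnion fun g hg => s.finite_toSet.biUnion fun h hh => ?_
    by_cases hgh : g = h
    · simp [hgh]
    · exact (hE.2 g (hsE hg) h (hsE hh) hgh).subset fun n hn => hn.2
  obtain ⟨n, hn, hn'⟩ := (hm.sdiff hfin).nonempty
  have hmaps : ∀ g ∈ s, g n ∈ Finset.range m := fun g hg =>
    Finset.mem_range.2 (by exact_mod_cast (hE.1 (hsE hg) n).trans_le hn)
  obtain ⟨g, hg, h, hh, hne, heq⟩ :=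
    Finset.exists_ne_map_eq_of_card_lt_of_maps_to (by simp [hs]) hmaps
  refine hn' ?_
  simp only [mem_iUnion]
  exact ⟨g, hg, h, hh, hne, heq⟩

lemma exists_isMEDF (F : ℕ → ℕ∞) : ∃ E : Set (ℕ → ℕ), IsMEDF F E := by
  obtain ⟨E, hE⟩ := zorn_subset {E | IsEDF F E} fun c hc hchain => by
    refine ⟨⋃₀ c, ⟨sUnion_subset fun E hE => (hc hE).1, ?_⟩, fun E hE => subset_sUnion_of_mem hE⟩
    rintro g₀ ⟨E₀, hE₀, hg₀⟩ g₁ ⟨E₁, hE₁, hg₁⟩ hne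
    rcases hchain.total hE₀ hE₁ with hsub | hsub
    · exact (hc hE₁).2 g₀ (hsub hg₀) g₁ hg₁ hne
    · exact (hc hE₀).2 g₀ hg₀ g₁ (hsub hg₁) hne
  exact ⟨E, hE.prop, fun E' hE' hsub => (hE.eq_of_subset hE' hsub).symm⟩

theorem stmt13 (F : ℕ → ℕ∞) (h1 : ∀ n, 1 ≤ F n) :
    Xor'
      ((∃ m : ℕ, {n : ℕ | F n ≤ (m : ℕ∞)}.Infinite) ∧
        (∀ E : Set (ℕ → ℕ), IsEDF F E → E.Finite) ∧
        (∃ E : Set (ℕ → ℕ), IsMEDF F E ∧ E.Finite))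
      ((∀ m : ℕ, ∀ᶠ n in Filter.atTop, (m : ℕ∞) < F n) ∧
        (∃ E : Set (ℕ → ℕ), IsMEDF F E ∧ IsClosed E ∧ Perfect E ∧ E.Nonempty) ∧
        (∀ E : Set (ℕ → ℕ), E.Countable → ¬ IsMEDF F E)) := by
  by_cases hF : ∀ m : ℕ, ∀ᶠ n in atTop, (m : ℕ∞) < F n
  · refine Or.inr ⟨⟨hF, exists_perfect_isMEDF h1 hF,
      fun E hE => not_isMEDF_of_countable h1 hF hE⟩, ?_⟩
    rintro ⟨⟨m, hm⟩, -⟩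
    refine hm ?_
    simpa [← Nat.cofinite_eq_atTop, eventually_cofinite] using hF m
  · refine Or.inl ⟨?_, fun h => hF h.1⟩
    obtain ⟨m, hm⟩ := not_forall.1 hF
    have hinf : {n : ℕ | F n ≤ (m : ℕ∞)}.Infinite := by
      simpa [← Nat.cofinite_eq_atTop, eventually_cofinite] using hm
    obtain ⟨E, hE⟩ := exists_isMEDF F
    exact ⟨⟨m, hinf⟩, fun E hE => hE.finite hinf, E, hE, hE.1.finite hinf⟩
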